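/- For all integers p ≥ 1 and q ≥ 1, the quantities â_{pq} = ∬_𝐐 L_p(ξ) L_q(η) / (2 − ξ − η) dξ dη satisfy the recurrence relation (â_{p,q+1} − â_{p,q−1})/(2q+1) = (â_{p+1,q} − â_{p−1,q})/(2p+1). -/

import Mathlib

noncomputable section

open Set MeasureTheory

/-- The reference square 𝐐 = (−1,1)². -/
def Qsq : Set (ℝ × ℝ) := Ioo (-1 : ℝ) 1 ×ˢ Ioo (-1 : ℝ) 1

/-- The Legendre polynomial of degree k, given by the Rodrigues formula
L_k(x) = 1/(2^k k!) d^k/dx^k (x²−1)^k. -/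
def legendre (k : ℕ) : Polynomial ℝ :=
  Polynomial.C (1 / (2 ^ k * (Nat.factorial k : ℝ))) *
    (Polynomial.derivative^[k] ((Polynomial.X ^ 2 - 1) ^ k))

/-- â_{pq} = ∬_𝐐 L_p(ξ) L_q(η)/(2 − ξ − η) dξ dη. -/
def ahat (p q : ℕ) : ℝ :=
  ∫ z in Qsq, (legendre p).eval z.1 * (legendre q).eval z.2 / (2 - z.1 - z.2)

lemma u_deriv2 (n : ℕ) : Polynomial.derivative (Polynomial.derivative
    (((Polynomial.X : Polynomial ℝ) ^ 2 - 1) ^ (n + 2))) =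
    Polynomial.C (2 * ((n:ℝ) + 2)) * (Polynomial.C (2 * (n:ℝ) + 3) * (Polynomial.X ^ 2 - 1) ^ (n + 1)
      + Polynomial.C (2 * ((n:ℝ) + 1)) * (Polynomial.X ^ 2 - 1) ^ n) := by
  simp only [Polynomial.derivative_pow, Polynomial.derivative_mul, Polynomial.derivative_sub,
    Polynomial.derivative_X, Polynomial.derivative_one, Polynomial.derivative_C,
    Polynomial.derivative_add, Polynomial.derivative_natCast, map_mul, map_add, map_natCast, map_ofNat, map_one,
    Nat.add_sub_cancel, Nat.cast_add, Nat.cast_ofNat, Nat.cast_one]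
  simp
  ring

/-- the primitive of the Legendre polynomial -/
def prim (n : ℕ) : Polynomial ℝ :=
  Polynomial.C (1 / (2 ^ (n+1) * (Nat.factorial (n+1) : ℝ))) *
    (Polynomial.derivative^[n] ((Polynomial.X ^ 2 - 1) ^ (n+1)))

lemma prim_deriv (n : ℕ) : Polynomial.derivative (prim n) = legendre (n+1) := by
  rw [prim, legendre, Polynomial.derivative_C_mul, Function.iterate_succ_apply']

lemma leg_sub (n : ℕ) : legendre (n+2) - legendre n = Polynomial.C (2 * (n:ℝ) + 3) * prim n := by
  rw [legendre, Function.iterate_add_apply]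
  simp only [Function.iterate_succ, Function.iterate_zero, Function.comp, id]
  rw [u_deriv2, Polynomial.iterate_derivative_C_mul, iterate_map_add,
    Polynomial.iterate_derivative_C_mul, Polynomial.iterate_derivative_C_mul, legendre, prim]
  generalize (Polynomial.derivative^[n] ((Polynomial.X ^ 2 - 1 : Polynomial ℝ) ^ (n+1))) = A
  generalize (Polynomial.derivative^[n] ((Polynomial.X ^ 2 - 1 : Polynomial ℝ) ^ n)) = B
  have h : (Nat.factorial n : ℝ) ≠ 0 := by positivity
  have hn1 : (n : ℝ) + 1 ≠ 0 := by positivity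
  have hn2 : (n : ℝ) + 2 ≠ 0 := by positivity
  have e1 : 1 / (2 ^ (n+2) * (Nat.factorial (n+2) : ℝ)) * (2 * ((n:ℝ) + 2)) =
      1 / (2 ^ (n+1) * (Nat.factorial (n+1) : ℝ)) := by
    rw [Nat.factorial_succ (n+1)]; push_cast
    have : (Nat.factorial (n+1) : ℝ) ≠ 0 := by positivity
    have : (n : ℝ) + 1 + 1 ≠ 0 := by positivity
    field_simp
    ring
  have e2 : 1 / (2 ^ (n+1) * (Nat.factorial (n+1) : ℝ)) * (2 * ((n:ℝ) + 1)) =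
      1 / (2 ^ n * (Nat.factorial n : ℝ)) := by
    rw [Nat.factorial_succ n]; push_cast
    field_simp
    ring
  rw [← mul_assoc, ← Polynomial.C_mul, e1, mul_add, ← mul_assoc _ _ B, ← Polynomial.C_mul, e2]
  ring

lemma prim_dvd (n : ℕ) : ((Polynomial.X : Polynomial ℝ) ^ 2 - 1) ∣ prim n := by
  have := Polynomial.pow_sub_dvd_iterate_derivative_pow ((Polynomial.X : Polynomial ℝ) ^ 2 - 1) (n+1) n
  rw [Nat.add_sub_cancel_left, pow_one] at this
  exact Dvd.dvd.mul_left this _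

lemma poly_bdd (P : Polynomial ℝ) : ∃ C, 0 ≤ C ∧ ∀ x ∈ Ioo (-1:ℝ) 1, |P.eval x| ≤ C := by
  obtain ⟨C, hC⟩ := (isCompact_Icc (a := (-1:ℝ)) (b := 1)).exists_bound_of_continuousOn
    (f := fun x => P.eval x) P.continuous.continuousOn
  exact ⟨C, (norm_nonneg _).trans (hC 0 (by norm_num)), fun x hx => hC x ⟨hx.1.le, hx.2.le⟩⟩

lemma meas_Q : MeasurableSet Qsq := measurableSet_Ioo.prod measurableSet_Ioo

lemma vol_Q : (volume.restrict Qsq : Measure (ℝ × ℝ)) =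
    (volume.restrict (Ioo (-1:ℝ) 1)).prod (volume.restrict (Ioo (-1:ℝ) 1)) := by
  rw [Measure.prod_restrict]; rfl

lemma int_half : IntegrableOn (fun x : ℝ => (1 - x) ^ (-(1/2) : ℝ)) (Ioo (-1:ℝ) 1) := by
  have h := (intervalIntegral.intervalIntegrable_rpow' (a := 2) (b := 0) (r := -(1/2)) (by norm_num)).comp_sub_left 1
  norm_num at h
  rw [intervalIntegrable_iff_integrableOn_Ioo_of_le (by norm_num)] at h
  norm_num
  exact h

lemma int_g : IntegrableOn (fun z : ℝ × ℝ => 1 / (2 - z.1 - z.2)) Qsq := by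
  have h := Integrable.mul_prod int_half int_half
  rw [← vol_Q] at h
  refine Integrable.mono' h (Measurable.aestronglyMeasurable (by fun_prop)) ?_
  refine (ae_restrict_iff' meas_Q).2 (Filter.Eventually.of_forall ?_)
  rintro ⟨x, y⟩ ⟨⟨hx1, hx2⟩, ⟨hy1, hy2⟩⟩
  simp only at *
  have ha : 0 < 1 - x := by linarith
  have hb : 0 < 1 - y := by linarith
  rw [Real.norm_of_nonneg (one_div_nonneg.2 (by linarith)), Real.rpow_neg ha.le, Real.rpow_neg hb.le,
    ← Real.sqrt_eq_rpow, ← Real.sqrt_eq_rpow, ← mul_inv, ← one_div]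
  have h1 := Real.sqrt_pos.2 ha
  have h2 := Real.sqrt_pos.2 hb
  apply one_div_le_one_div_of_le (by positivity)
  nlinarith [Real.sq_sqrt ha.le, Real.sq_sqrt hb.le, sq_nonneg (√(1-x) - √(1-y))]

lemma int_fg (f : ℝ × ℝ → ℝ) (hf : Measurable f) (C : ℝ) (hC : ∀ z ∈ Qsq, |f z| ≤ C) :
    IntegrableOn (fun z : ℝ × ℝ => f z / (2 - z.1 - z.2)) Qsq := by
  have := Integrable.bdd_mul (c := C) int_g (f := f) hf.aestronglyMeasurable
    ((ae_restrict_iff' meas_Q).2 (Filter.Eventually.of_forall hC))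
  simpa [IntegrableOn, div_eq_mul_inv] using this

lemma poly_meas (A B : Polynomial ℝ) : Measurable (fun z : ℝ × ℝ => A.eval z.1 * B.eval z.2) :=
  ((A.continuous.comp continuous_fst).mul (B.continuous.comp continuous_snd)).measurable

lemma int_poly (A B : Polynomial ℝ) :
    IntegrableOn (fun z : ℝ × ℝ => A.eval z.1 * B.eval z.2 / (2 - z.1 - z.2)) Qsq := by
  obtain ⟨a, ha, hA⟩ := poly_bdd A
  obtain ⟨b, hb, hB⟩ := poly_bdd B
  refine int_fg _ (poly_meas A B) (a * b) ?_
  rintro z ⟨h1, h2⟩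
  rw [abs_mul]
  exact mul_le_mul (hA _ h1) (hB _ h2) (abs_nonneg _) ha

lemma int_poly2 (A B : Polynomial ℝ) (hB : (Polynomial.X ^ 2 - 1) ∣ B) :
    IntegrableOn (fun z : ℝ × ℝ => A.eval z.1 * B.eval z.2 / (2 - z.1 - z.2) ^ 2) Qsq := by
  obtain ⟨R, rfl⟩ := hB
  obtain ⟨a, ha, hA⟩ := poly_bdd A
  obtain ⟨b, hb, hB⟩ := poly_bdd ((Polynomial.X + 1) * R)
  have := int_fg (fun z : ℝ × ℝ => A.eval z.1 * ((Polynomial.X ^ 2 - 1) * R).eval z.2 / (2 - z.1 - z.2))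
    ((poly_meas _ _).div (by fun_prop)) (a * b) ?_
  · simpa only [div_div, ← pow_two] using this
  rintro ⟨x, y⟩ ⟨h1, h2⟩
  have h3 := hA _ h1
  have h4 := hB _ h2
  simp only at *
  have hx := h1.2
  have hy := h2.2
  have hd : 0 < 2 - x - y := by linarith
  have e : A.eval x * ((Polynomial.X ^ 2 - 1) * R).eval y / (2 - x - y) =
      A.eval x * (((Polynomial.X + 1) * R).eval y * ((y - 1) / (2 - x - y))) := by
    simp; ring
  rw [e, abs_mul, abs_mul]
  have h5 : |(y - 1) / (2 - x - y)| ≤ 1 := by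
    rw [abs_div, abs_of_pos hd, div_le_one hd, abs_le]
    constructor <;> linarith
  refine mul_le_mul h3 ?_ (by positivity) ha
  calc _ ≤ b * 1 := mul_le_mul h4 h5 (abs_nonneg _) hb
    _ = b := mul_one b

lemma key (P Q : Polynomial ℝ) (hP : (Polynomial.X ^ 2 - 1) ∣ P) (hQ : (Polynomial.X ^ 2 - 1) ∣ Q) :
    ∫ z in Qsq, (Polynomial.derivative P).eval z.1 * Q.eval z.2 / (2 - z.1 - z.2) =
    - ∫ z in Qsq, P.eval z.1 * Q.eval z.2 / (2 - z.1 - z.2) ^ 2 := by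
  have i1 := int_poly (Polynomial.derivative P) Q
  have i2 := int_poly2 P Q hQ
  rw [eq_neg_iff_add_eq_zero, ← integral_add i1 i2]
  have i3 := i1.add i2
  rw [vol_Q] at *
  rw [integral_prod_symm _ (by unfold IntegrableOn at i3; rw [vol_Q] at i3; exact i3)]
  refine (setIntegral_congr_fun (g := fun _ => 0) measurableSet_Ioo ?_).trans (by simp)
  intro y hy
  have hy2 := hy.2
  have hne : ∀ x ∈ Icc (-1:ℝ) 1, 2 - x - y ≠ 0 := fun x hx => by
    have := hx.2
    linarith [hx.2] |> fun (h : 0 < 2 - x - y) => h.ne'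
  simp only
  rw [← integral_Ioc_eq_integral_Ioo, ← intervalIntegral.integral_of_le (by norm_num)]
  have hu : uIcc (-1:ℝ) 1 = Icc (-1) 1 := uIcc_of_le (by norm_num)
  rw [intervalIntegral.integral_eq_sub_of_hasDerivAt (f := fun x => P.eval x * Q.eval y / (2 - x - y))]
  · obtain ⟨R, rfl⟩ := hP
    simp
  · intro x hx
    rw [hu] at hx
    have h := hne x hx
    have := ((P.hasDerivAt x).mul_const (Q.eval y)).div
      (((hasDerivAt_id x).const_sub 2).sub_const y) h
    refine HasDerivAt.congr_deriv this ?_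
    simp only [id]
    field_simp
    ring
  · apply ContinuousOn.intervalIntegrable
    rw [hu]
    refine ContinuousOn.add (ContinuousOn.div ?_ (by fun_prop) hne)
      (ContinuousOn.div ?_ (by fun_prop) fun x hx => pow_ne_zero 2 (hne x hx))
    · exact ((Polynomial.derivative P).continuous.mul continuous_const).continuousOn
    · exact (P.continuous.mul continuous_const).continuousOn

lemma swap_Q (f : ℝ × ℝ → ℝ) : ∫ z in Qsq, f z.swap = ∫ z in Qsq, f z := by
  rw [vol_Q]
  exact integral_prod_swap f

lemma ahat_symm (p q : ℕ) : ahat p q = ahat q p := by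
  rw [ahat, ← swap_Q]
  unfold ahat
  congr 1
  ext z
  simp only [Prod.fst_swap, Prod.snd_swap]
  ring

lemma ahat_diff (m n : ℕ) : (ahat (m + 2) (n + 1) - ahat m (n + 1)) / (2 * (m:ℝ) + 3) =
    ∫ z in Qsq, (Polynomial.derivative (prim n)).eval z.2 * (prim m).eval z.1 / (2 - z.1 - z.2) := by
  have h : 2 * (m:ℝ) + 3 ≠ 0 := by positivity
  rw [ahat, ahat, ← integral_sub (int_poly _ _) (int_poly _ _), div_eq_iff h, ← integral_mul_const]
  congr 1
  ext z
  have := congrArg (Polynomial.eval z.1) (leg_sub m)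
  simp only [Polynomial.eval_sub, Polynomial.eval_mul, Polynomial.eval_C] at this
  rw [prim_deriv, ← sub_div, ← sub_mul, this]
  ring

/-- The recurrence relation
(â_{p,q+1} − â_{p,q−1})/(2q+1) = (â_{p+1,q} − â_{p−1,q})/(2p+1) for p, q ≥ 1. -/
theorem ahat_recurrence (p q : ℕ) (hp : 1 ≤ p) (hq : 1 ≤ q) :
    (ahat p (q + 1) - ahat p (q - 1)) / (2 * (q : ℝ) + 1) =
      (ahat (p + 1) q - ahat (p - 1) q) / (2 * (p : ℝ) + 1) := by
  obtain ⟨m, rfl⟩ := Nat.exists_eq_add_of_le' hp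
  obtain ⟨n, rfl⟩ := Nat.exists_eq_add_of_le' hq
  have main : ∀ m n : ℕ, (ahat (m + 2) (n + 1) - ahat m (n + 1)) / (2 * (m:ℝ) + 3) =
      - ∫ z in Qsq, (prim n).eval z.1 * (prim m).eval z.2 / (2 - z.1 - z.2) ^ 2 := by
    intro m n
    rw [ahat_diff, ← key _ _ (prim_dvd n) (prim_dvd m), ← swap_Q]
    congr 1
    ext z
    simp only [Prod.fst_swap, Prod.snd_swap]
    ring
  have c : ∀ k : ℕ, 2 * ((k + 1 : ℕ) : ℝ) + 1 = 2 * (k:ℝ) + 3 := by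
    intro k; push_cast; ring
  rw [c, c, Nat.add_sub_cancel, Nat.add_sub_cancel, ahat_symm (m+1), ahat_symm (m+1), main n m, main m n,
    ← swap_Q]
  congr 2
  ext z
  simp only [Prod.fst_swap, Prod.snd_swap]
  ring
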